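/- arXiv:2107.00944 — 2 statements merged into one kernel-verified Lean document; each statement's English description precedes it below -/
import Mathlib

section
/- Let D be a commutative Noetherian ring and A = D[X,Y]/(XY - a) for some a ∈ D. Then the nilradical of A equals the extension to A of the nilradical of D. In particular, A is reduced if and only if D is reduced. -/
open MvPolynomial

/-- The commutative generalized Weyl algebra of rank 1: `A = D[X,Y]/(XY - a)`. -/
noncomputable abbrev GWA (D : Type*) [CommRing D] (a : D) : Type _ :=
  MvPolynomial (Fin 2) D ⧸ (Ideal.span {X 0 * X 1 - C a} : Ideal (MvPolynomial (Fin 2) D))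

open scoped LaurentPolynomial

/-- Evaluating `f` at `c T⁻¹` and multiplying by `c T⁻¹` gives only negative powers of `T`. -/
theorem LaurentPolynomial.trunc_mul_aeval_C_mul_T_neg_one {D R : Type*} [CommRing D] [CommRing R]
    [Algebra D R] (c : R) (f : Polynomial D) :
    trunc ((C c * T (-1)) * Polynomial.aeval (C c * T (-1) : R[T;T⁻¹]) f) = 0 := by
  induction f using Polynomial.induction_on' with
  | add f g hf hg => rw [map_add, mul_add, map_add, hf, hg, add_zero]
  | monomial n r =>
    have h : (C c * T (-1)) * Polynomial.aeval (C c * T (-1) : R[T;T⁻¹]) (Polynomial.monomial n r) =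
        C (algebraMap D R r * c ^ (n + 1)) * T (-(n + 1 : ℤ)) := by
      rw [Polynomial.aeval_monomial, LaurentPolynomial.algebraMap_apply, mul_left_comm, ← pow_succ',
        mul_pow, T_pow, ← map_pow, ← mul_assoc, ← map_mul]
      congr 2
      push_cast
      ring
    rw [h, trunc_C_mul_T, if_neg (by lia)]

theorem LaurentPolynomial.aeval_T_one {D R : Type*} [CommRing D] [CommRing R] [Algebra D R]
    (f : Polynomial D) :
    Polynomial.aeval (T 1 : R[T;T⁻¹]) f = (f.map (algebraMap D R)).toLaurent := by
  induction f using Polynomial.induction_on' with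
  | add f g hf hg => simp only [map_add, Polynomial.map_add, hf, hg]
  | monomial n r =>
    rw [Polynomial.aeval_monomial, LaurentPolynomial.algebraMap_apply, T_pow, mul_one,
      Polynomial.map_monomial, ← Polynomial.C_mul_X_pow_eq_monomial,
      Polynomial.toLaurent_C_mul_X_pow]

namespace GWA

variable {D : Type*} [CommRing D] (a : D)

/-- The class of `X` in `D[X,Y]/(XY - a)`. -/
noncomputable def x : GWA D a := Ideal.Quotient.mk _ (X 0)

/-- The class of `Y` in `D[X,Y]/(XY - a)`. -/
noncomputable def y : GWA D a := Ideal.Quotient.mk _ (X 1)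

theorem x_mul_y : x a * y a = algebraMap D (GWA D a) a := by
  rw [x, y, ← map_mul]
  exact Ideal.Quotient.eq.2 (Ideal.subset_span rfl)

variable {a} in
/-- The universal property of `D[X,Y]/(XY - a)`. -/
theorem exists_algHom {B : Type*} [CommRing B] [Algebra D B] {u v : B}
    (h : u * v = algebraMap D B a) :
    ∃ φ : GWA D a →ₐ[D] B, φ (x a) = u ∧ φ (y a) = v := by
  refine ⟨Ideal.Quotient.liftₐ _ (MvPolynomial.aeval ![u, v]) fun f hf ↦ ?_, ?_, ?_⟩
  · have : Ideal.span {X 0 * X 1 - C a} ≤ RingHom.ker (MvPolynomial.aeval (R := D) ![u, v]) := by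
      rw [Ideal.span_singleton_le_iff_mem, RingHom.mem_ker]
      simp [h]
    exact this hf
  · exact (MvPolynomial.aeval_X _ _).trans rfl
  · exact (MvPolynomial.aeval_X _ _).trans rfl

variable {a} in
theorem induction {p : GWA D a → Prop} (algebraMap : ∀ d, p (algebraMap D _ d))
    (add : ∀ f g, p f → p g → p (f + g)) (mul_x : ∀ f, p f → p (f * x a))
    (mul_y : ∀ f, p f → p (f * y a)) (f : GWA D a) : p f := by
  obtain ⟨f, rfl⟩ := Ideal.Quotient.mk_surjective f
  induction f using MvPolynomial.induction_on with
  | C d => exact algebraMap d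
  | add f g hf hg => rw [map_add]; exact add _ _ hf hg
  | mul_X f i hf =>
    rw [map_mul]
    fin_cases i
    · exact mul_x _ hf
    · exact mul_y _ hf

/-- Every element is a polynomial in `x` plus a polynomial in `y` without constant term. -/
theorem exists_eq_aeval_add_mul_aeval (f : GWA D a) :
    ∃ p q : Polynomial D, f = Polynomial.aeval (x a) p + y a * Polynomial.aeval (y a) q := by
  induction f using GWA.induction with
  | algebraMap d => exact ⟨Polynomial.C d, 0, by simp⟩
  | add f g hf hg =>
    obtain ⟨p, q, rfl⟩ := hf
    obtain ⟨p', q', rfl⟩ := hg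
    exact ⟨p + p', q + q', by simp only [map_add]; ring⟩
  | mul_x f hf =>
    obtain ⟨p, q, rfl⟩ := hf
    refine ⟨Polynomial.X * p + Polynomial.C (a * q.coeff 0), Polynomial.C a * q.divX, ?_⟩
    have hq := congrArg (Polynomial.aeval (y a)) (Polynomial.divX_mul_X_add q)
    simp only [map_add, map_mul, Polynomial.aeval_X, Polynomial.aeval_C] at hq ⊢
    rw [← x_mul_y, ← hq]
    ring
  | mul_y f hf =>
    obtain ⟨p, q, rfl⟩ := hf
    refine ⟨Polynomial.C a * p.divX, Polynomial.C (p.coeff 0) + Polynomial.X * q, ?_⟩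
    have hp := congrArg (Polynomial.aeval (x a)) (Polynomial.divX_mul_X_add p)
    simp only [map_add, map_mul, Polynomial.aeval_X, Polynomial.aeval_C] at hp ⊢
    rw [← x_mul_y, ← hp]
    ring

end GWA

open LaurentPolynomial in
/-- If elements `u` and `v` of a `D`-algebra are mapped to `T` and `a T⁻¹` by homomorphisms to the
Laurent polynomial rings over all the domains `D ⧸ P`, and `p(u) + v q(v)` is nilpotent, then so
are all the coefficients of `p`. -/
theorem isNilpotent_coeff_of_isNilpotent_aeval_add_mul_aeval {D A : Type*} [CommRing D]
    [CommRing A] [Algebra D A] {a : D} {u v : A}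
    (h : ∀ P : Ideal D, P.IsPrime → ∃ φ : A →ₐ[D] (D ⧸ P)[T;T⁻¹],
      φ u = T 1 ∧ φ v = LaurentPolynomial.C (algebraMap D (D ⧸ P) a) * T (-1))
    {p q : Polynomial D}
    (hn : IsNilpotent (Polynomial.aeval u p + v * Polynomial.aeval v q)) (n : ℕ) :
    IsNilpotent (p.coeff n) := by
  rw [nilpotent_iff_mem_prime]
  intro P hP
  obtain ⟨φ, hu, hv⟩ := h P hP
  have h0 := congrArg trunc (hn.map φ).eq_zero
  rw [map_add, map_mul, ← Polynomial.aeval_algHom_apply, ← Polynomial.aeval_algHom_apply, hu, hv,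
    map_add, trunc_mul_aeval_C_mul_T_neg_one, aeval_T_one, Polynomial.trunc_toLaurent, map_zero,
    add_zero] at h0
  rw [← Ideal.Quotient.eq_zero_iff_mem]
  simpa using congrArg (Polynomial.coeff · n) h0

theorem Polynomial.aeval_mem_map_nilradical {D A : Type*} [CommRing D] [CommRing A] [Algebra D A]
    {p : Polynomial D} (h : ∀ n, IsNilpotent (p.coeff n)) (u : A) :
    aeval u p ∈ (nilradical D).map (algebraMap D A) := by
  rw [aeval_eq_sum_range]
  refine Ideal.sum_mem _ fun n _ ↦ ?_
  rw [Algebra.smul_def]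
  exact Ideal.mul_mem_right _ _ (Ideal.mem_map_of_mem _ (h n))

namespace GWA

variable {D : Type*} [CommRing D] (a : D)

theorem algebraMap_injective : Function.Injective (algebraMap D (GWA D a)) := by
  obtain ⟨φ, -, -⟩ := exists_algHom (a := a) (B := D) (one_mul a)
  exact Function.LeftInverse.injective (g := φ) φ.commutes

theorem map_nilradical_le :
    (nilradical D).map (algebraMap D (GWA D a)) ≤ nilradical (GWA D a) :=
  Ideal.map_le_iff_le_comap.2 fun _ hd ↦ (mem_nilradical.1 hd).map (algebraMap D (GWA D a))

open LaurentPolynomial in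
theorem nilradical_eq_map :
    nilradical (GWA D a) = (nilradical D).map (algebraMap D (GWA D a)) := by
  apply le_antisymm
  · intro f hf
    obtain ⟨p, q, rfl⟩ := exists_eq_aeval_add_mul_aeval a f
    have key (P : Ideal D) : (T 1 : (D ⧸ P)[T;T⁻¹]) *
        (LaurentPolynomial.C (algebraMap D (D ⧸ P) a) * T (-1)) = algebraMap D _ a := by
      rw [mul_left_comm, ← T_add, add_neg_cancel, T_zero, mul_one,
        LaurentPolynomial.algebraMap_apply]
    have hp := Polynomial.aeval_mem_map_nilradical
      (isNilpotent_coeff_of_isNilpotent_aeval_add_mul_aeval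
        (fun P _ ↦ exists_algHom (key P)) (mem_nilradical.1 hf)) (x a)
    refine Ideal.add_mem _ hp ?_
    have hpn : Polynomial.aeval (x a) p ∈ nilradical (GWA D a) :=
      map_nilradical_le a hp
    have hq : IsNilpotent (Polynomial.aeval (y a) (Polynomial.X * q) +
        x a * Polynomial.aeval (x a) (0 : Polynomial D)) := by
      simpa using mem_nilradical.1 ((Ideal.add_mem_iff_right _ hpn).1 hf)
    simpa using Polynomial.aeval_mem_map_nilradical
      (isNilpotent_coeff_of_isNilpotent_aeval_add_mul_aeval (fun P _ ↦
        (exists_algHom ((mul_comm _ _).trans (key P))).imp fun _ ↦ And.symm) hq) (y a)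
  · exact map_nilradical_le a

theorem isReduced_iff : IsReduced (GWA D a) ↔ IsReduced D := by
  refine ⟨fun _ ↦ isReduced_of_injective _ (algebraMap_injective a), fun _ ↦ ?_⟩
  rw [← nilradical_eq_bot_iff, nilradical_eq_map, nilradical_eq_zero, Ideal.zero_eq_bot,
    Ideal.map_bot]

end GWA

/-- The nilradical of `A = D[X,Y]/(XY - a)` is the extension of the nilradical of `D`.
In particular, `A` is reduced iff `D` is reduced. -/
theorem gwa_nilradical (D : Type*) [CommRing D] [IsNoetherianRing D] (a : D) :
    nilradical (GWA D a) = (nilradical D).map (algebraMap D (GWA D a)) ∧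
    (IsReduced (GWA D a) ↔ IsReduced D) :=
  ⟨GWA.nilradical_eq_map a, GWA.isReduced_iff a⟩
end

section
/- Let D be a commutative Noetherian ring of pure dimension d (i.e., dim(D/p) = d for every minimal prime p of D), a ∈ D, and A = D[X,Y]/(XY - a). Then A has pure dimension d + 1. -/
open MvPolynomial

/-- The polynomial `XY - a` stays nonzero under every change of coefficients to a nontrivial
ring. -/
lemma map_mul_X_sub_C_ne_zero {D E : Type*} [CommRing D] [CommRing E] [Nontrivial E]
    (φ : D →+* E) (a : D) :
    MvPolynomial.map φ (X 0 * X 1 - C a : MvPolynomial (Fin 2) D) ≠ 0 := by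
  intro h
  have h2 := congrArg (MvPolynomial.coeff (Finsupp.single (0 : Fin 2) 1 + Finsupp.single 1 1)) h
  have hne : (0 : Fin 2 →₀ ℕ) ≠ Finsupp.single 0 1 + Finsupp.single 1 1 := by
    intro h
    simpa using DFunLike.congr_fun h 0
  simp only [map_sub, map_mul, MvPolynomial.map_X, MvPolynomial.map_C, coeff_sub,
    coeff_mul_X, coeff_X, coeff_C, if_neg hne, coeff_zero] at h2
  simp at h2

lemma Ideal.ker_le_of_comp_eq_mk {R S : Type*} [CommRing R] [CommRing S] {Q : Ideal R}
    (φ : R →+* S) (ψ : S →+* R ⧸ Q) (h : ψ.comp φ = Ideal.Quotient.mk Q) :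
    RingHom.ker φ ≤ Q := by
  intro g hg
  rw [← Ideal.Quotient.eq_zero_iff_mem, ← h, RingHom.comp_apply, RingHom.mem_ker.mp hg, map_zero]

/-- A prime minimal over `XY - a` contracts to a minimal prime of `D`. -/
lemma comap_C_mem_minimalPrimes {D : Type*} [CommRing D] [IsNoetherianRing D] {a : D}
    {Q : Ideal (MvPolynomial (Fin 2) D)}
    (hQ : Q ∈ (Ideal.span {X 0 * X 1 - C a}).minimalPrimes) :
    Q.comap C ∈ minimalPrimes D := by
  have hQp : Q.IsPrime := hQ.1.1
  have hfQ : (X 0 * X 1 - C a : MvPolynomial (Fin 2) D) ∈ Q :=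
    hQ.1.2 (Ideal.subset_span rfl)
  have hht := Ideal.height_le_one_of_isPrincipal_of_mem_minimalPrimes _ Q hQ
  have ker_eq (p : Ideal D) : RingHom.ker (MvPolynomial.map (σ := Fin 2) (Ideal.Quotient.mk p)) =
      p.map C := by
    rw [MvPolynomial.ker_map, Ideal.mk_ker]
  have prime_ker (p : Ideal D) [p.IsPrime] :
      (p.map (C : D →+* MvPolynomial (Fin 2) D)).IsPrime := by
    rw [← ker_eq]
    exact RingHom.ker_isPrime _
  refine ⟨⟨inferInstance, bot_le⟩, fun p hp hpq ↦ ?_⟩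
  by_contra hne
  have := hp.1
  have h₁ : p.map (C : D →+* MvPolynomial (Fin 2) D) < (Q.comap C).map C := by
    refine lt_of_le_not_ge (Ideal.map_mono hpq) fun hle ↦ hne fun x hx ↦ ?_
    have hx' := hle (Ideal.mem_map_of_mem C hx)
    rw [← ker_eq, RingHom.mem_ker, MvPolynomial.map_C, MvPolynomial.C_eq_zero] at hx'
    exact Ideal.Quotient.eq_zero_iff_mem.mp hx'
  have h₂ : (Q.comap C).map C < Q := by
    refine lt_of_le_not_ge Ideal.map_comap_le fun hle ↦ ?_
    have hf := hle hfQ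
    rw [← ker_eq, RingHom.mem_ker] at hf
    exact map_mul_X_sub_C_ne_zero _ _ hf
  have h₃ := Ideal.height_add_one_le_of_lt_of_isPrime h₁
  have h₄ := Ideal.height_add_one_le_of_lt_of_isPrime h₂
  have h₅ : (1 : ℕ∞) + 1 ≤ 1 :=
    ((add_le_add_left (le_add_self.trans h₃) 1).trans h₄).trans hht
  norm_num at h₅

/-- A prime minimal over `XY - a` does not contain both variables. -/
lemma X_notMem_of_X_mem {D : Type*} [CommRing D] {a : D} {i j : Fin 2} (hij : i ≠ j)
    {Q : Ideal (MvPolynomial (Fin 2) D)}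
    (hQ : Q ∈ (Ideal.span {X i * X j - C a}).minimalPrimes) (hi : X i ∈ Q) : X j ∉ Q := by
  have hQp : Q.IsPrime := hQ.1.1
  have ha : a ∈ Q.comap C := by
    have := Q.sub_mem (Q.mul_mem_right (X j) hi) (hQ.1.2 (Ideal.subset_span rfl))
    simpa using this
  let φ : MvPolynomial (Fin 2) D →+* Polynomial (D ⧸ Q.comap C) :=
    eval₂Hom (Polynomial.C.comp (Ideal.Quotient.mk _)) (fun k ↦ if k = i then 0 else Polynomial.X)
  let ψ : Polynomial (D ⧸ Q.comap C) →+* MvPolynomial (Fin 2) D ⧸ Q :=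
    Polynomial.eval₂RingHom (Ideal.quotientMap Q C le_rfl) (Ideal.Quotient.mk Q (X j))
  have hle : RingHom.ker φ ≤ Q := by
    refine Ideal.ker_le_of_comp_eq_mk φ ψ (MvPolynomial.ringHom_ext (by simp [φ, ψ]) fun k ↦ ?_)
    by_cases hk : k = i
    · subst hk
      simpa [φ, ψ] using (Ideal.Quotient.eq_zero_iff_mem.mpr hi).symm
    · obtain rfl : k = j := by omega
      simp [φ, ψ, hk]
  have hge : Q ≤ RingHom.ker φ := by
    refine hQ.2 ⟨RingHom.ker_isPrime _, ?_⟩ hle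
    rw [Ideal.span_singleton_le_iff_mem, RingHom.mem_ker]
    simp [φ, Ideal.Quotient.eq_zero_iff_mem.mpr ha]
  intro hj
  simpa [φ, hij.symm] using hge hj

/-- The lower bound for a component on which `X i` does not vanish identically: it contains the
section `X i = 1`, a copy of `D / (Q ∩ D)`, as a proper closed subset. -/
lemma ringKrullDim_comap_add_one_le_of_X_notMem {D : Type*} [CommRing D] {a : D} {i j : Fin 2}
    (hij : i ≠ j) {Q : Ideal (MvPolynomial (Fin 2) D)}
    (hQ : Q ∈ (Ideal.span {X i * X j - C a}).minimalPrimes) (hi : X i ∉ Q) :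
    ringKrullDim (D ⧸ Q.comap C) + 1 ≤ ringKrullDim (MvPolynomial (Fin 2) D ⧸ Q) := by
  have hQp : Q.IsPrime := hQ.1.1
  let π := Ideal.Quotient.mk (Q.comap C)
  let φ : MvPolynomial (Fin 2) D →+* LaurentPolynomial (D ⧸ Q.comap C) :=
    eval₂Hom (LaurentPolynomial.C.comp π)
      (fun k ↦ if k = i then .T 1 else LaurentPolynomial.C (π a) * .T (-1))
  let K := FractionRing (MvPolynomial (Fin 2) D ⧸ Q)
  let ι : MvPolynomial (Fin 2) D ⧸ Q →+* K := algebraMap _ _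
  have hι : Function.Injective ι := IsFractionRing.injective _ _
  have hx : ι (Ideal.Quotient.mk Q (X i)) ≠ 0 := by
    rwa [Ne, map_eq_zero_iff _ hι, Ideal.Quotient.eq_zero_iff_mem]
  let ψ : LaurentPolynomial (D ⧸ Q.comap C) →+* K :=
    LaurentPolynomial.eval₂ (ι.comp (Ideal.quotientMap Q C le_rfl)) (Units.mk0 _ hx)
  have hprod : ι (Ideal.Quotient.mk Q (C a)) =
      ι (Ideal.Quotient.mk Q (X i)) * ι (Ideal.Quotient.mk Q (X j)) := by
    rw [← map_mul, ← map_mul]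
    exact congrArg ι (Ideal.Quotient.eq.mpr (hQ.1.2 (Ideal.subset_span rfl))).symm
  have hcomp : ψ.comp φ = ι.comp (Ideal.Quotient.mk Q) := by
    refine MvPolynomial.ringHom_ext (by simp [φ, ψ, π]) fun k ↦ ?_
    by_cases hk : k = i
    · subst hk
      simp [φ, ψ]
    · obtain rfl : k = j := by omega
      simp only [φ, ψ, π, RingHom.comp_apply, coe_eval₂Hom, eval₂_X, if_neg hk, map_mul,
        LaurentPolynomial.eval₂_C, LaurentPolynomial.eval₂_T, Ideal.quotientMap_mk, hprod]
      simp only [zpow_neg, zpow_one, Units.val_inv_eq_inv_val, Units.val_mk0]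
      rw [mul_right_comm, mul_inv_cancel₀ hx, one_mul]
  have hle : RingHom.ker φ ≤ Q := by
    intro g hg
    rw [← Ideal.Quotient.eq_zero_iff_mem, ← map_eq_zero_iff _ hι, ← RingHom.comp_apply, ← hcomp,
      RingHom.comp_apply, RingHom.mem_ker.mp hg, map_zero]
  have hge : Q ≤ RingHom.ker φ := by
    refine hQ.2 ⟨RingHom.ker_isPrime _, ?_⟩ hle
    rw [Ideal.span_singleton_le_iff_mem, RingHom.mem_ker]
    simp only [φ, map_sub, map_mul, coe_eval₂Hom, eval₂_X, eval₂_C, if_neg hij.symm, if_true,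
      RingHom.comp_apply]
    rw [mul_left_comm, ← LaurentPolynomial.T_add]
    simp
  let ε : LaurentPolynomial (D ⧸ Q.comap C) →+* D ⧸ Q.comap C :=
    LaurentPolynomial.eval₂ (RingHom.id _) 1
  let σ : MvPolynomial (Fin 2) D ⧸ Q →+* D ⧸ Q.comap C :=
    Ideal.Quotient.lift Q (ε.comp φ) fun g hg ↦ by
      rw [RingHom.comp_apply, RingHom.mem_ker.mp (hge hg), map_zero]
  have hσ : Function.Surjective σ := by
    intro y
    obtain ⟨y, rfl⟩ := Ideal.Quotient.mk_surjective y
    exact ⟨Ideal.Quotient.mk Q (C y), by simp [σ, ε, φ, π]⟩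
  refine ringKrullDim_succ_le_of_surjective σ hσ (r := Ideal.Quotient.mk Q (X i - 1))
    (mem_nonZeroDivisors_of_ne_zero fun h ↦ ?_) (by simp [σ, ε, φ])
  have h₁ := hge (Ideal.Quotient.eq_zero_iff_mem.mp h)
  have h₂ : Polynomial.toLaurent (Polynomial.X : Polynomial (D ⧸ Q.comap C)) =
      Polynomial.toLaurent 1 := by
    simpa [φ, sub_eq_zero] using h₁
  simpa [Polynomial.coeff_one] using
    congrArg (Polynomial.coeff · 1) (Polynomial.toLaurent_injective h₂)

/-- The upper bound: a prime containing `XY - a` has dimension at most one more than its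
contraction to `D`. -/
lemma ringKrullDim_quotient_add_one_le_of_mem {D : Type*} [CommRing D] [IsNoetherianRing D]
    {a : D} {Q : Ideal (MvPolynomial (Fin 2) D)} [Q.IsPrime] (hQ : X 0 * X 1 - C a ∈ Q) :
    ringKrullDim (MvPolynomial (Fin 2) D ⧸ Q) + 1 ≤ ringKrullDim (D ⧸ Q.comap C) + 1 + 1 := by
  let τ : MvPolynomial (Fin 2) (D ⧸ Q.comap C) →+* MvPolynomial (Fin 2) D ⧸ Q :=
    eval₂Hom (Ideal.quotientMap Q C le_rfl) (fun k ↦ Ideal.Quotient.mk Q (X k))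
  have hcomp : τ.comp (MvPolynomial.map (Ideal.Quotient.mk _)) = Ideal.Quotient.mk Q :=
    MvPolynomial.ringHom_ext (by simp [τ]) (by simp [τ])
  have hτ : Function.Surjective τ := by
    refine Function.Surjective.of_comp (g := MvPolynomial.map (Ideal.Quotient.mk _)) ?_
    rw [← RingHom.coe_comp, hcomp]
    exact Ideal.Quotient.mk_surjective
  have := ringKrullDim_succ_le_of_surjective τ hτ
    (mem_nonZeroDivisors_of_ne_zero (map_mul_X_sub_C_ne_zero (Ideal.Quotient.mk (Q.comap C)) a))
    (by rw [← RingHom.comp_apply, hcomp, Ideal.Quotient.eq_zero_iff_mem.mpr hQ])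
  simpa [add_assoc, one_add_one_eq_two] using this

/-- If the commutative Noetherian ring `D` has pure dimension `d` (i.e.
`dim (D/p) = d` for every minimal prime `p`), then `A = D[X,Y]/(XY - a)` has
pure dimension `d + 1`. -/
theorem gwa_pure_dimension (D : Type*) [CommRing D] [IsNoetherianRing D] (a : D) (d : ℕ)
    (hD : ∀ p ∈ minimalPrimes D, ringKrullDim (D ⧸ p) = d) :
    ∀ P ∈ minimalPrimes (GWA D a), ringKrullDim (GWA D a ⧸ P) = d + 1 := by
  intro P hP
  obtain ⟨Q, hQ, hdim⟩ : ∃ Q ∈ (Ideal.span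
      {(X 0 * X 1 - C a : MvPolynomial (Fin 2) D)}).minimalPrimes,
      ringKrullDim (MvPolynomial (Fin 2) D ⧸ Q) = ringKrullDim (GWA D a ⧸ P) := by
    let mkA := Ideal.Quotient.mk (Ideal.span {(X 0 * X 1 - C a : MvPolynomial (Fin 2) D)})
    have hker : RingHom.ker ((Ideal.Quotient.mk P).comp mkA) = P.comap mkA := by
      rw [← RingHom.comap_ker, Ideal.mk_ker]
    refine ⟨P.comap mkA, ?_, ringKrullDim_eq_of_ringEquiv ((Ideal.quotEquivOfEq hker.symm).trans
      (RingHom.quotientKerEquivOfSurjective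
        (Ideal.Quotient.mk_surjective.comp Ideal.Quotient.mk_surjective)))⟩
    rw [Ideal.minimalPrimes_eq_comap]
    exact ⟨P, hP, rfl⟩
  have hQp : Q.IsPrime := hQ.1.1
  have hd := hD _ (comap_C_mem_minimalPrimes hQ)
  have hupper := ringKrullDim_quotient_add_one_le_of_mem (hQ.1.2 (Ideal.subset_span rfl))
  have hlower : ringKrullDim (D ⧸ Q.comap C) + 1 ≤ ringKrullDim (MvPolynomial (Fin 2) D ⧸ Q) := by
    by_cases hX : X 0 ∈ Q
    · have hY := X_notMem_of_X_mem (by decide) hQ hX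
      rw [mul_comm] at hQ
      exact ringKrullDim_comap_add_one_le_of_X_notMem (by decide) hQ hY
    · exact ringKrullDim_comap_add_one_le_of_X_notMem (by decide) hQ hX
  rw [hd] at hupper hlower
  rw [← hdim]
  exact le_antisymm (ENat.WithBot.add_le_add_one_right_iff.mp hupper) hlower
end
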